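/- Let d ≥ 1, c > 0, and let x⃗ : ℝ → ℝ^d be a smooth curve with |x⃗'(t)| < c for all t. Define the relativistic acceleration a = D v (v = D x, x(t) = (c t, x⃗(t))), the relativistic jerk j = b + (η(b, v)/c²) v (b = D a), and the relativistic snap s = D j + (η(D j, v)/c²) v, and set B⃗ = b⃗ + 3 γ² ((v⃗·a⃗)/c²) a⃗, H⃗ = B⃗' + 3 γ² ((v⃗·a⃗)/c²) B⃗ + γ² ((v⃗·B⃗)/c²) a⃗. Then for every t: a(t) = 0 in ℝ × ℝ^d if and only if a⃗(t) = 0 in ℝ^d; j(t) = 0 if and only if B⃗(t) = 0; and s(t) = 0 if and only if H⃗(t) = 0. -/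

import Mathlib

open scoped RealInnerProductSpace

/-- The Minkowski inner product on `ℝ × ℝ^d`: `η((s,u),(r,w)) = −s r + u·w`. -/
noncomputable def minkowski {d : ℕ} (Z W : ℝ × EuclideanSpace ℝ (Fin d)) : ℝ :=
  -(Z.1 * W.1) + ⟪Z.2, W.2⟫

/-- The component of `Z` that is `η`-orthogonal to a four-velocity `u`, i.e. to a vector
with `η(u, u) = -c²`. -/
noncomputable def minkowskiProj {d : ℕ} (c : ℝ) (u Z : ℝ × EuclideanSpace ℝ (Fin d)) :
    ℝ × EuclideanSpace ℝ (Fin d) :=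
  Z + (minkowski Z u / c ^ 2) • u

section MinkowskiProj

variable {d : ℕ}

theorem minkowski_add_left (Z W u : ℝ × EuclideanSpace ℝ (Fin d)) :
    minkowski (Z + W) u = minkowski Z u + minkowski W u := by
  simp only [minkowski, Prod.fst_add, Prod.snd_add, inner_add_left]
  ring

theorem minkowski_smul_left (r : ℝ) (Z u : ℝ × EuclideanSpace ℝ (Fin d)) :
    minkowski (r • Z) u = r * minkowski Z u := by
  simp only [minkowski, Prod.smul_fst, Prod.smul_snd, real_inner_smul_left, smul_eq_mul]
  ring

theorem minkowski_zero_smul (c g : ℝ) (v w : EuclideanSpace ℝ (Fin d)) :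
    minkowski (0, w) (g • (c, v)) = g * ⟪v, w⟫ := by
  simp [minkowski, real_inner_smul_right, real_inner_comm]

theorem minkowskiProj_add (c : ℝ) (u Z W : ℝ × EuclideanSpace ℝ (Fin d)) :
    minkowskiProj c u (Z + W) = minkowskiProj c u Z + minkowskiProj c u W := by
  simp only [minkowskiProj, minkowski_add_left]
  module

theorem minkowskiProj_smul (c r : ℝ) (u Z : ℝ × EuclideanSpace ℝ (Fin d)) :
    minkowskiProj c u (r • Z) = r • minkowskiProj c u Z := by
  simp only [minkowskiProj, minkowski_smul_left]
  module

theorem minkowskiProj_self {c : ℝ} (hc : c ≠ 0) {u : ℝ × EuclideanSpace ℝ (Fin d)}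
    (hu : minkowski u u = -c ^ 2) : minkowskiProj c u u = 0 := by
  have h : -c ^ 2 / c ^ 2 = -1 := by field_simp
  rw [minkowskiProj, hu, h]
  module

theorem minkowskiProj_spatial_eq_zero_iff {c g : ℝ} (hc : c ≠ 0) (hg : g ≠ 0)
    (v w : EuclideanSpace ℝ (Fin d)) :
    minkowskiProj c (g • (c, v)) (0, w) = 0 ↔ w = 0 := by
  constructor
  · intro h
    have hk : minkowski (0, w) (g • (c, v)) / c ^ 2 = 0 := by
      simpa [minkowskiProj, hc, hg] using congrArg Prod.fst h
    rw [minkowskiProj, hk, zero_smul, add_zero] at h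
    exact congrArg Prod.snd h
  · rintro rfl
    simp [minkowskiProj, minkowski]

end MinkowskiProj

section Lorentz

variable {d : ℕ}

theorem lorentz_radicand_pos {c : ℝ} {v : EuclideanSpace ℝ (Fin d)} (hv : ‖v‖ < c) :
    0 < 1 - ‖v‖ ^ 2 / c ^ 2 := by
  have hc : 0 < c := (norm_nonneg v).trans_lt hv
  have : ‖v‖ ^ 2 < c ^ 2 := by gcongr
  rw [sub_pos, div_lt_one (by positivity)]
  exact this

theorem minkowski_fourVelocity_self {c : ℝ} {v : EuclideanSpace ℝ (Fin d)} (hv : ‖v‖ < c)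
    {g : ℝ} (hg : g = (1 - ‖v‖ ^ 2 / c ^ 2) ^ (-(1 / 2) : ℝ)) :
    minkowski (g • (c, v)) (g • (c, v)) = -c ^ 2 := by
  have hc : 0 < c := (norm_nonneg v).trans_lt hv
  have hp := lorentz_radicand_pos hv
  have hsq : g ^ 2 * (1 - ‖v‖ ^ 2 / c ^ 2) = 1 := by
    rw [hg, ← Real.rpow_natCast, ← Real.rpow_mul hp.le]
    norm_num [Real.rpow_neg_one, hp.ne']
  have h : minkowski (g • (c, v)) (g • (c, v)) =
      -c ^ 2 * (g ^ 2 * (1 - ‖v‖ ^ 2 / c ^ 2)) := by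
    simp only [minkowski, Prod.smul_fst, Prod.smul_snd, smul_eq_mul, real_inner_self_eq_norm_sq,
      norm_smul, mul_pow, Real.norm_eq_abs, sq_abs]
    field_simp
    ring
  rw [h, hsq, mul_one]

theorem hasDerivAt_lorentz {c : ℝ} {v : ℝ → EuclideanSpace ℝ (Fin d)}
    {a : EuclideanSpace ℝ (Fin d)} {γ : ℝ → ℝ}
    (hγ : ∀ t, γ t = (1 - ‖v t‖ ^ 2 / c ^ 2) ^ (-(1 / 2) : ℝ)) {t : ℝ} (hv : ‖v t‖ < c)
    (ha : HasDerivAt v a t) :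
    HasDerivAt γ (γ t ^ 3 * (⟪v t, a⟫ / c ^ 2)) t := by
  have hp := lorentz_radicand_pos hv
  have h := ((ha.norm_sq.div_const (c ^ 2)).const_sub 1).rpow_const
    (p := (-(1 / 2) : ℝ)) (Or.inl hp.ne')
  have hcube : γ t ^ 3 = (1 - ‖v t‖ ^ 2 / c ^ 2) ^ (-(1 / 2) - 1 : ℝ) := by
    rw [hγ, ← Real.rpow_natCast, ← Real.rpow_mul hp.le]
    norm_num
  rw [funext hγ] at hcube ⊢
  refine h.congr_deriv ?_
  rw [hcube]
  ring

/-- The normal component of the proper-time derivative of `γⁿ` times the normal component of a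
spatial vector field. -/
theorem minkowskiProj_properTime_deriv {c : ℝ} {v w : ℝ → EuclideanSpace ℝ (Fin d)}
    {a w' : EuclideanSpace ℝ (Fin d)} {γ : ℝ → ℝ}
    (hγ : ∀ t, γ t = (1 - ‖v t‖ ^ 2 / c ^ 2) ^ (-(1 / 2) : ℝ)) {t : ℝ} (hv : ‖v t‖ < c)
    (ha : HasDerivAt v a t) (hw : HasDerivAt w w' t) (n : ℕ) :
    minkowskiProj c (γ t • (c, v t))
        (γ t • deriv (fun r => γ r ^ n • minkowskiProj c (γ r • (c, v r)) (0, w r)) t) =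
      γ t ^ (n + 1) • minkowskiProj c (γ t • (c, v t))
        (0, w' + (n * γ t ^ 2 * (⟪v t, a⟫ / c ^ 2)) • w t
          + (γ t ^ 2 * (⟪v t, w t⟫ / c ^ 2)) • a) := by
  have hc : c ≠ 0 := ((norm_nonneg _).trans_lt hv).ne'
  have hu := minkowski_fourVelocity_self hv (hγ t)
  have hg := hasDerivAt_lorentz hγ hv ha
  have hW : HasDerivAt (fun r => ((0 : ℝ), w r)) (0, w') t := (hasDerivAt_const t 0).prodMk hw
  have hV : HasDerivAt (fun r => (c, v r)) (0, a) t := (hasDerivAt_const t c).prodMk ha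
  have hk := (hg.mul (ha.inner ℝ hw)).div_const (c ^ 2)
  have hF := (hg.pow n).smul (hW.add (hk.smul (hg.smul hV)))
  have hfun : (fun r => γ r ^ n • minkowskiProj c (γ r • (c, v r)) (0, w r)) =
      γ ^ n • ((fun r => ((0 : ℝ), w r)) +
        (fun r => (γ * fun r => ⟪v r, w r⟫) r / c ^ 2) • (γ • fun r => (c, v r))) := by
    ext1 r
    simp only [minkowskiProj, minkowski_zero_smul, Pi.smul_apply', Pi.mul_apply, Pi.pow_apply,
      Pi.add_apply]
  have hcv : minkowskiProj c (γ t • (c, v t)) (c, v t) = 0 := by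
    have hγ0 : γ t ≠ 0 := by
      rw [hγ]; exact (Real.rpow_pos_of_pos (lorentz_radicand_pos hv) _).ne'
    have := minkowskiProj_self hc hu
    rw [minkowskiProj_smul] at this
    exact (smul_eq_zero.mp this).resolve_left hγ0
  have hsplit : ((0 : ℝ), w' + (n * γ t ^ 2 * (⟪v t, a⟫ / c ^ 2)) • w t
          + (γ t ^ 2 * (⟪v t, w t⟫ / c ^ 2)) • a) =
      (0, w') + (n * γ t ^ 2 * (⟪v t, a⟫ / c ^ 2)) • (0, w t)
          + (γ t ^ 2 * (⟪v t, w t⟫ / c ^ 2)) • (0, a) := by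
    simp
  rw [hfun, hF.deriv, hsplit]
  simp only [Pi.smul_apply', Pi.mul_apply, Pi.pow_apply, Pi.add_apply, minkowskiProj_add,
    minkowskiProj_smul, hcv, smul_zero, add_zero]
  rcases n with _ | n
  · simp only [Nat.cast_zero]
    module
  · simp only [Nat.add_sub_cancel]
    module

end Lorentz

/-- The vanishing of the relativistic acceleration, jerk and snap is equivalent,
in each case, to the vanishing of the spatial vectors `a⃗`, `B⃗` and `H⃗` respectively. -/
theorem vanishing_relativistic_vectors_iff (d : ℕ) (hd : 1 ≤ d) (c : ℝ) (hc : 0 < c)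
    (xv : ℝ → EuclideanSpace ℝ (Fin d)) (hx : ContDiff ℝ (⊤ : ℕ∞) xv)
    (vv : ℝ → EuclideanSpace ℝ (Fin d)) (hvv : vv = deriv xv)
    (av : ℝ → EuclideanSpace ℝ (Fin d)) (hav : av = deriv vv)
    (bv : ℝ → EuclideanSpace ℝ (Fin d)) (hbv : bv = deriv av)
    (hspeed : ∀ t : ℝ, ‖vv t‖ < c)
    (γ : ℝ → ℝ) (hγ : ∀ t, γ t = (1 - ‖vv t‖ ^ 2 / c ^ 2) ^ (-(1 / 2) : ℝ))
    (X : ℝ → ℝ × EuclideanSpace ℝ (Fin d)) (hX : ∀ t, X t = (c * t, xv t))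
    (v4 : ℝ → ℝ × EuclideanSpace ℝ (Fin d)) (hv4 : ∀ t, v4 t = γ t • deriv X t)
    (a4 : ℝ → ℝ × EuclideanSpace ℝ (Fin d)) (ha4 : ∀ t, a4 t = γ t • deriv v4 t)
    (b4 : ℝ → ℝ × EuclideanSpace ℝ (Fin d)) (hb4 : ∀ t, b4 t = γ t • deriv a4 t)
    (j : ℝ → ℝ × EuclideanSpace ℝ (Fin d))
    (hj : ∀ t, j t = b4 t + (minkowski (b4 t) (v4 t) / c ^ 2) • v4 t)
    (s : ℝ → ℝ × EuclideanSpace ℝ (Fin d))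
    (hs : ∀ t, s t = γ t • deriv j t
      + (minkowski (γ t • deriv j t) (v4 t) / c ^ 2) • v4 t)
    (B : ℝ → EuclideanSpace ℝ (Fin d))
    (hB : ∀ t, B t = bv t + (3 * γ t ^ 2 * (⟪vv t, av t⟫ / c ^ 2)) • av t)
    (H : ℝ → EuclideanSpace ℝ (Fin d))
    (hH : ∀ t, H t = deriv B t + (3 * γ t ^ 2 * (⟪vv t, av t⟫ / c ^ 2)) • B t
      + (γ t ^ 2 * (⟪vv t, B t⟫ / c ^ 2)) • av t) :
    ∀ t : ℝ,
      (a4 t = 0 ↔ av t = 0) ∧ (j t = 0 ↔ B t = 0) ∧ (s t = 0 ↔ H t = 0) := by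
  have hc0 : c ≠ 0 := hc.ne'
  have hv : ContDiff ℝ (⊤ : ℕ∞) vv := hvv ▸ (contDiff_infty_iff_deriv.mp hx).2
  have ha : ContDiff ℝ (⊤ : ℕ∞) av := hav ▸ (contDiff_infty_iff_deriv.mp hv).2
  have hb : ContDiff ℝ (⊤ : ℕ∞) bv := hbv ▸ (contDiff_infty_iff_deriv.mp ha).2
  have diff {f : ℝ → EuclideanSpace ℝ (Fin d)} (hf : ContDiff ℝ (⊤ : ℕ∞) f) (t : ℝ) :
      HasDerivAt f (deriv f t) t := (contDiff_infty_iff_deriv.mp hf).1.differentiableAt.hasDerivAt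
  have dv (t : ℝ) : HasDerivAt vv (av t) t := hav ▸ diff hv t
  have da (t : ℝ) : HasDerivAt av (bv t) t := hbv ▸ diff ha t
  have dγ (t : ℝ) := hasDerivAt_lorentz hγ (hspeed t) (dv t)
  have γ0 (t : ℝ) : γ t ≠ 0 := by
    rw [hγ]; exact (Real.rpow_pos_of_pos (lorentz_radicand_pos (hspeed t)) _).ne'
  have dB (t : ℝ) : HasDerivAt B (deriv B t) t := by
    rw [funext hB]
    have hγd := (dγ t).differentiableAt
    have hvd := (dv t).differentiableAt
    have had := (da t).differentiableAt
    have hbd := (diff hb t).differentiableAt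
    have hid := hvd.inner ℝ had
    exact DifferentiableAt.hasDerivAt (by fun_prop)
  have v4_eq (t : ℝ) : v4 t = γ t • (c, vv t) := by
    have h : HasDerivAt X (c, vv t) t := by
      rw [funext hX, hvv]
      simpa using ((hasDerivAt_id t).const_mul c).prodMk (diff hx t)
    rw [hv4, h.deriv]
  have a4_eq (t : ℝ) : a4 t = γ t ^ 2 • minkowskiProj c (γ t • (c, vv t)) (0, av t) := by
    have h := (dγ t).smul ((hasDerivAt_const t c).prodMk (dv t))
    have hfun : v4 = γ • fun r => (c, vv r) := funext v4_eq
    rw [ha4, hfun, h.deriv, minkowskiProj, minkowski_zero_smul]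
    module
  have j_eq (t : ℝ) : j t = γ t ^ 3 • minkowskiProj c (γ t • (c, vv t)) (0, B t) := by
    have h := minkowskiProj_properTime_deriv hγ (hspeed t) (dv t) (da t) 2
    rw [← funext a4_eq, ← hb4, ← v4_eq] at h
    rw [hj, ← v4_eq, hB]
    refine h.trans ?_
    congr 3
    push_cast
    module
  have s_eq (t : ℝ) : s t = γ t ^ 4 • minkowskiProj c (γ t • (c, vv t)) (0, H t) := by
    have h := minkowskiProj_properTime_deriv hγ (hspeed t) (dv t) (dB t) 3
    rw [← funext j_eq, ← v4_eq] at h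
    rw [hs, ← v4_eq, hH]
    exact_mod_cast h
  intro t
  rw [a4_eq, j_eq, s_eq]
  simp only [smul_eq_zero, pow_ne_zero _ (γ0 t), false_or, minkowskiProj_spatial_eq_zero_iff hc0 (γ0 t), and_self]
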